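/- Fix m ≥ 3 and positive reals π_0,…,π_{2m} with Π = Σ_{i=1}^{m}(π_{2i−1}+π_{2i}) ≤ 2π_0. Suppose for each i = 1,…,m that 0 ≤ q_{2i−1,2i} ≤ (Π/(2π_0+Π))·min{π_{2i−1}, π_{2i}}, and set q_{0,2i−1} = 2π_0π_{2i−1}/(2π_0+Π) and q_{0,2i} = 2π_0π_{2i}/(2π_0+Π). Then P = I − D^{−1}L(q) is a stochastic matrix and its SLEM equals μ(P) = Π/(2π_0+Π). -/

import Mathlib

open Matrix Polynomial

/-- The symmetric Laplacian `L(q)` of a weight function `q`: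
off-diagonal entry `(i,j)` is `-q i j`, diagonal entry `(i,i)` is `∑_{k ≠ i} q i k`. -/
noncomputable def lap {n : ℕ} (q : Fin n → Fin n → ℝ) : Matrix (Fin n) (Fin n) ℝ :=
  Matrix.of fun i j => if i = j then ∑ k ∈ Finset.univ.erase i, q i k else -(q i j)

/-- The reversible transition matrix `P = I - D⁻¹ L(q)` with `D = diag(pr)`. -/
noncomputable def transP {n : ℕ} (pr : Fin n → ℝ) (q : Fin n → Fin n → ℝ) :
    Matrix (Fin n) (Fin n) ℝ :=
  1 - (Matrix.diagonal pr)⁻¹ * lap q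

/-- A (row-)stochastic matrix: nonnegative entries, each row summing to one. -/
def IsStochastic {n : ℕ} (M : Matrix (Fin n) (Fin n) ℝ) : Prop :=
  (∀ i j, 0 ≤ M i j) ∧ ∀ i, ∑ j, M i j = 1

/-- The second largest eigenvalue modulus: the supremum of `|lam|` over real
eigenvalues `lam` of `M` (roots of the characteristic polynomial, with
multiplicity), after removing one copy of the eigenvalue `1`. -/
noncomputable def slem {n : ℕ} (M : Matrix (Fin n) (Fin n) ℝ) : ℝ :=
  sSup {r : ℝ | ∃ lam ∈ (Matrix.charpoly M).roots.erase 1, r = |lam|}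

/-- Central vertex of the friendship graph `F_m`. -/
def v0 {m : ℕ} : Fin (2*m+1) := ⟨0, by omega⟩
/-- Vertex `2i-1` (first friend of blade `i`, with `i` running over `Fin m`). -/
def v1 {m : ℕ} (i : Fin m) : Fin (2*m+1) := ⟨2*(i:ℕ)+1, by have := i.isLt; omega⟩
/-- Vertex `2i` (second friend of blade `i`). -/
def v2 {m : ℕ} (i : Fin m) : Fin (2*m+1) := ⟨2*(i:ℕ)+2, by have := i.isLt; omega⟩

/-- Edge relation of the friendship graph `F_m`. -/
def IsEdge {m : ℕ} (a b : Fin (2*m+1)) : Prop :=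
  ∃ i : Fin m,
    ({a, b} : Set (Fin (2*m+1))) = {v0, v1 i} ∨
    ({a, b} : Set (Fin (2*m+1))) = {v0, v2 i} ∨
    ({a, b} : Set (Fin (2*m+1))) = {v1 i, v2 i}

section Friendship

variable {m : ℕ}

lemma sum_friendship (g : Fin (2 * m + 1) → ℝ) :
    ∑ k, g k = g v0 + ∑ i : Fin m, (g (v1 i) + g (v2 i)) := by
  have key : ∀ (h : ℕ → ℝ) (n : ℕ), ∑ k ∈ Finset.range (2 * n + 1), h k =
      h 0 + ∑ i ∈ Finset.range n, (h (2 * i + 1) + h (2 * i + 2)) := by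
    intro h n
    induction n with
    | zero => simp
    | succ n ih =>
      rw [show 2 * (n + 1) + 1 = 2 * n + 1 + 1 + 1 by ring, Finset.sum_range_succ,
        Finset.sum_range_succ, ih, Finset.sum_range_succ]
      ring
  have hk := key (fun k => if hk : k < 2 * m + 1 then g ⟨k, hk⟩ else 0) m
  rw [Finset.sum_range, Finset.sum_range] at hk
  have e0 (k : Fin (2 * m + 1)) : (k : ℕ) ≤ 2 * m := by omega
  have e1 (i : Fin m) : 2 * (i : ℕ) + 1 < 2 * m + 1 := by omega
  have e2 (i : Fin m) : 2 * (i : ℕ) + 2 < 2 * m + 1 := by omega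
  simpa [v0, v1, v2, e0, e1, e2] using hk

lemma vertex_cases (v : Fin (2 * m + 1)) : v = v0 ∨ (∃ i, v = v1 i) ∨ ∃ i, v = v2 i := by
  obtain ⟨k, hk⟩ := v
  simp only [v0, v1, v2, Fin.mk.injEq]
  rcases Nat.eq_zero_or_pos k with h | h
  · exact Or.inl h
  rcases Nat.even_or_odd' k with ⟨c, hc | hc⟩
  · exact Or.inr (Or.inr ⟨⟨c - 1, by omega⟩, by simp only; omega⟩)
  · exact Or.inr (Or.inl ⟨⟨c, by omega⟩, by simp only; omega⟩)

lemma isEdge_iff {a b : Fin (2 * m + 1)} : IsEdge a b ↔ ∃ i : Fin m,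
    (a = v0 ∧ b = v1 i ∨ a = v1 i ∧ b = v0) ∨ (a = v0 ∧ b = v2 i ∨ a = v2 i ∧ b = v0) ∨
      (a = v1 i ∧ b = v2 i ∨ a = v2 i ∧ b = v1 i) := by
  simp only [IsEdge, Set.pair_eq_pair_iff]

lemma not_isEdge_v0_v0 : ¬ IsEdge (v0 : Fin (2 * m + 1)) v0 := by
  simp [isEdge_iff, v0, v1, v2]

lemma not_isEdge_v1_v1 (i j : Fin m) : ¬ IsEdge (v1 i) (v1 j) := by
  simp only [isEdge_iff, v0, v1, v2, Fin.mk.injEq]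
  rintro ⟨k, h⟩
  omega

lemma not_isEdge_v2_v2 (i j : Fin m) : ¬ IsEdge (v2 i) (v2 j) := by
  simp only [isEdge_iff, v0, v1, v2, Fin.mk.injEq]
  rintro ⟨k, h⟩
  omega

lemma not_isEdge_v1_v2 {i j : Fin m} (hij : i ≠ j) : ¬ IsEdge (v1 i) (v2 j) := by
  have := Fin.val_ne_of_ne hij
  simp only [isEdge_iff, v0, v1, v2, Fin.mk.injEq]
  rintro ⟨k, h⟩
  omega

variable {q : Fin (2 * m + 1) → Fin (2 * m + 1) → ℝ}

lemma sum_row_v0 (hedge : ∀ a b, ¬ IsEdge a b → q a b = 0) (g : Fin (2 * m + 1) → ℝ) :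
    ∑ k, q v0 k * g k =
      ∑ i : Fin m, (q v0 (v1 i) * g (v1 i) + q v0 (v2 i) * g (v2 i)) := by
  rw [sum_friendship, hedge _ _ not_isEdge_v0_v0, zero_mul, zero_add]

lemma sum_row_v1 (hsymm : ∀ a b, q a b = q b a) (hedge : ∀ a b, ¬ IsEdge a b → q a b = 0)
    (g : Fin (2 * m + 1) → ℝ) (i : Fin m) :
    ∑ k, q (v1 i) k * g k = q v0 (v1 i) * g v0 + q (v1 i) (v2 i) * g (v2 i) := by
  rw [sum_friendship, Finset.sum_eq_single i, hedge _ _ (not_isEdge_v1_v1 i i), hsymm _ v0]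
  · ring
  · intro j _ hj
    rw [hedge _ _ (not_isEdge_v1_v1 i j), hedge _ _ (not_isEdge_v1_v2 hj.symm)]
    ring
  · simp

lemma sum_row_v2 (hsymm : ∀ a b, q a b = q b a) (hedge : ∀ a b, ¬ IsEdge a b → q a b = 0)
    (g : Fin (2 * m + 1) → ℝ) (i : Fin m) :
    ∑ k, q (v2 i) k * g k = q v0 (v2 i) * g v0 + q (v1 i) (v2 i) * g (v1 i) := by
  rw [sum_friendship, Finset.sum_eq_single i, hedge _ _ (not_isEdge_v2_v2 i i), hsymm _ v0,
    hsymm (v2 i)]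
  · ring
  · intro j _ hj
    rw [hedge _ _ (not_isEdge_v2_v2 i j), hsymm, hedge _ _ (not_isEdge_v1_v2 hj)]
    ring
  · simp

end Friendship

section Transition

variable {n : ℕ}

lemma transP_apply {pr : Fin n → ℝ} (hpr : ∀ v, 0 < pr v) (q : Fin n → Fin n → ℝ) (i j : Fin n) :
    transP pr q i j =
      (if i = j then 1 - (pr i)⁻¹ * ∑ k, q i k else 0) + (pr i)⁻¹ * q i j := by
  have hinv : (Matrix.diagonal pr)⁻¹ = Matrix.diagonal fun i => (pr i)⁻¹ := by
    refine Matrix.inv_eq_left_inv ?_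
    rw [Matrix.diagonal_mul_diagonal, ← Matrix.diagonal_one]
    congr 1
    ext v
    exact inv_mul_cancel₀ (hpr v).ne'
  rw [transP, hinv, Matrix.sub_apply, Matrix.diagonal_mul, lap, Matrix.of_apply, Matrix.one_apply]
  split_ifs with h
  · subst h
    rw [← Finset.add_sum_erase _ _ (Finset.mem_univ i)]
    ring
  · ring

lemma transP_mulVec {pr : Fin n → ℝ} (hpr : ∀ v, 0 < pr v) (q : Fin n → Fin n → ℝ)
    (f : Fin n → ℝ) (v : Fin n) :
    (transP pr q *ᵥ f) v = f v - (pr v)⁻¹ * ∑ k, q v k * (f v - f k) := by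
  simp only [Matrix.mulVec, dotProduct, transP_apply hpr, add_mul, Finset.sum_add_distrib,
    ite_mul, zero_mul, Finset.sum_ite_eq, Finset.mem_univ, if_true, mul_sub,
    Finset.sum_sub_distrib, ← Finset.sum_mul, mul_assoc, ← Finset.mul_sum]
  ring

lemma sum_transP {pr : Fin n → ℝ} (hpr : ∀ v, 0 < pr v) (q : Fin n → Fin n → ℝ) (v : Fin n) :
    ∑ j, transP pr q v j = 1 := by
  simpa [Matrix.mulVec, dotProduct] using transP_mulVec hpr q (fun _ => 1) v

lemma isStochastic_transP {pr : Fin n → ℝ} (hpr : ∀ v, 0 < pr v) {q : Fin n → Fin n → ℝ}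
    (hq : ∀ a b, 0 ≤ q a b) (hrow : ∀ v, ∑ k, q v k ≤ pr v) : IsStochastic (transP pr q) := by
  refine ⟨fun i j => ?_, sum_transP hpr q⟩
  have h1 : (pr i)⁻¹ * ∑ k, q i k ≤ 1 := by
    rw [inv_mul_le_iff₀ (hpr i), mul_one]
    exact hrow i
  have h2 : 0 ≤ (pr i)⁻¹ * q i j := mul_nonneg (inv_nonneg.2 (hpr i).le) (hq i j)
  rw [transP_apply hpr]
  split_ifs <;> linarith

lemma mul_transP_comm {pr : Fin n → ℝ} (hpr : ∀ v, 0 < pr v) {q : Fin n → Fin n → ℝ}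
    (hsymm : ∀ a b, q a b = q b a) (i j : Fin n) :
    pr i * transP pr q i j = pr j * transP pr q j i := by
  rcases eq_or_ne i j with rfl | h
  · rfl
  · have hi := (hpr i).ne'
    have hj := (hpr j).ne'
    rw [transP_apply hpr, transP_apply hpr, if_neg h, if_neg h.symm, hsymm j i, zero_add, zero_add]
    field_simp

end Transition

section Reversible

variable {n : ℕ}

lemma mem_roots_charpoly_iff {M : Matrix (Fin n) (Fin n) ℝ} {lam : ℝ} :
    lam ∈ M.charpoly.roots ↔ ∃ f : Fin n → ℝ, f ≠ 0 ∧ M *ᵥ f = lam • f := by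
  rw [Polynomial.mem_roots M.charpoly_monic.ne_zero, Polynomial.IsRoot.def, Matrix.eval_charpoly,
    ← Matrix.exists_mulVec_eq_zero_iff]
  refine exists_congr fun f => and_congr_right fun _ => ?_
  rw [Matrix.sub_mulVec, sub_eq_zero, eq_comm]
  simp [← Matrix.smul_one_eq_diagonal, Matrix.scalar_apply, Matrix.smul_mulVec]

/-- For a matrix reversible with respect to the weights `w` and with unit row sums, every
eigenvalue that remains after removing one copy of `1` has an eigenvector of mean zero. -/
lemma exists_mean_zero_eigenvector {M : Matrix (Fin n) (Fin n) ℝ} {w : Fin n → ℝ}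
    (hw : ∀ i, 0 < w i) (hM : ∀ i j, w i * M i j = w j * M j i) (hrow : ∀ i, ∑ j, M i j = 1)
    {lam : ℝ} (hlam : lam ∈ M.charpoly.roots.erase 1) :
    ∃ f : Fin n → ℝ, f ≠ 0 ∧ M *ᵥ f = lam • f ∧ ∑ i, w i * f i = 0 := by
  by_cases h1 : lam = 1
  · subst h1
    set S : Matrix (Fin n) (Fin n) ℝ := Matrix.diagonal fun i => √(w i) with hS
    set T : Matrix (Fin n) (Fin n) ℝ := Matrix.diagonal fun i => (√(w i))⁻¹ with hT
    have hs (i) : √(w i) ≠ 0 := (Real.sqrt_pos.2 (hw i)).ne'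
    have hTS : T * S = 1 := by
      rw [hS, hT, Matrix.diagonal_mul_diagonal, ← Matrix.diagonal_one]
      congr 1
      ext i
      exact inv_mul_cancel₀ (hs i)
    have hH : (S * M * T).IsHermitian := by
      ext i j
      have hi := hs i
      have hj := hs j
      have h := hM i j
      rw [← Real.mul_self_sqrt (hw i).le, ← Real.mul_self_sqrt (hw j).le] at h
      simp only [hS, hT, Matrix.conjTranspose_apply, Matrix.mul_diagonal, Matrix.diagonal_mul,
        star_trivial]
      field_simp
      linarith
    have hchar : (S * M * T).charpoly = M.charpoly := by
      rw [Matrix.charpoly_mul_comm, ← Matrix.mul_assoc, hTS, Matrix.one_mul]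
    have hcount : 2 ≤ M.charpoly.roots.count 1 := by
      have := Multiset.count_pos.2 hlam
      rw [Multiset.count_erase_self] at this
      omega
    rw [← hchar, hH.roots_charpoly_eq_eigenvalues, Multiset.count_map] at hcount
    obtain ⟨i, hi, j, hj, hij⟩ := Finset.one_lt_card.1
      (show 1 < (Finset.univ.filter fun i => (1 : ℝ) = hH.eigenvalues i).card from hcount)
    have hi' := (Finset.mem_filter.1 hi).2
    have hj' := (Finset.mem_filter.1 hj).2
    have hfix {k} (hk : 1 = hH.eigenvalues k) :
        (S * M * T) *ᵥ ⇑(hH.eigenvectorBasis k) = ⇑(hH.eigenvectorBasis k) := by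
      rw [hH.mulVec_eigenvectorBasis, ← hk, one_smul]
    have hli : ∀ a b : ℝ,
        a • ⇑(hH.eigenvectorBasis i) + b • ⇑(hH.eigenvectorBasis j) = 0 → a = 0 ∧ b = 0 := by
      intro a b hab
      have h : a • hH.eigenvectorBasis i + b • hH.eigenvectorBasis j = 0 := by
        ext k
        simpa using congrFun hab k
      constructor
      · simpa [inner_add_right, inner_smul_right, hH.eigenvectorBasis.inner_eq_ite, hij] using
          congrArg (inner ℝ (hH.eigenvectorBasis i)) h
      · simpa [inner_add_right, inner_smul_right, hH.eigenvectorBasis.inner_eq_ite, hij.symm] using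
          congrArg (inner ℝ (hH.eigenvectorBasis j)) h
    obtain ⟨u, hu, hHu, hwu⟩ : ∃ u : Fin n → ℝ, u ≠ 0 ∧ (S * M * T) *ᵥ u = u ∧
        (fun i => √(w i)) ⬝ᵥ u = 0 := by
      set ui : Fin n → ℝ := ⇑(hH.eigenvectorBasis i)
      set uj : Fin n → ℝ := ⇑(hH.eigenvectorBasis j)
      set s : Fin n → ℝ := fun i => √(w i)
      by_cases hc : s ⬝ᵥ ui = 0
      · exact ⟨ui, fun h => one_ne_zero (hli 1 0 (by simp [h])).1, hfix hi', hc⟩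
      · refine ⟨(s ⬝ᵥ uj) • ui + (-(s ⬝ᵥ ui)) • uj, fun h => hc (neg_eq_zero.1 (hli _ _ h).2),
          ?_, ?_⟩
        · rw [Matrix.mulVec_add, Matrix.mulVec_smul, Matrix.mulVec_smul, hfix hi', hfix hj']
        · rw [dotProduct_add, dotProduct_smul, dotProduct_smul, smul_eq_mul, smul_eq_mul]
          ring
    refine ⟨T *ᵥ u, fun h => hu ?_, ?_, ?_⟩
    · rw [← Matrix.one_mulVec u, ← mul_eq_one_comm.1 hTS, ← Matrix.mulVec_mulVec, h,
        Matrix.mulVec_zero]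
    · rw [one_smul]
      nth_rewrite 2 [← hHu]
      rw [Matrix.mulVec_mulVec, Matrix.mulVec_mulVec, ← Matrix.mul_assoc, ← Matrix.mul_assoc, hTS,
        Matrix.one_mul]
    · rw [← hwu]
      refine Finset.sum_congr rfl fun k _ => ?_
      have hk := hs k
      rw [hT, Matrix.mulVec_diagonal]
      nth_rewrite 1 [← Real.mul_self_sqrt (hw k).le]
      field_simp
  · obtain ⟨f, hf, hMf⟩ := mem_roots_charpoly_iff.1 ((Multiset.mem_erase_of_ne h1).1 hlam)
    refine ⟨f, hf, hMf, ?_⟩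
    have h : ∑ i, w i * (M *ᵥ f) i = ∑ i, w i * f i := by
      simp only [Matrix.mulVec, dotProduct, Finset.mul_sum]
      rw [Finset.sum_comm]
      refine Finset.sum_congr rfl fun j _ => ?_
      simp only [← mul_assoc, hM _ j]
      rw [← Finset.sum_mul, ← Finset.mul_sum, hrow, mul_one]
    rw [hMf] at h
    simp only [Pi.smul_apply, smul_eq_mul, mul_left_comm _ lam, ← Finset.mul_sum] at h
    exact (mul_eq_zero.1 (by linarith : (lam - 1) * ∑ i, w i * f i = 0)).resolve_left
      (sub_ne_zero.2 h1)

end Reversible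

/-- An eigenvalue equation in the coordinate of larger modulus bounds the eigenvalue. -/
lemma abs_le_of_weighted_pair {p c r lam x y : ℝ} (hp : 0 < p) (hc : 0 ≤ c) (hcr : c ≤ r * p)
    (hyx : |y| ≤ |x|) (hx : x ≠ 0) (h : p * (lam * x) = (r * p - c) * x + c * y) : |lam| ≤ r := by
  have hx' := abs_pos.2 hx
  have h1 : p * (|lam| * |x|) ≤ (r * p - c) * |x| + c * |y| := by
    calc p * (|lam| * |x|) = |(r * p - c) * x + c * y| := by
          rw [← h, abs_mul, abs_mul, abs_of_pos hp]
      _ ≤ |(r * p - c) * x| + |c * y| := abs_add_le _ _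
      _ = _ := by rw [abs_mul, abs_mul, abs_of_nonneg hc, abs_of_nonneg (sub_nonneg.2 hcr)]
  refine le_of_mul_le_mul_right ?_ (mul_pos hp hx')
  nlinarith [mul_le_mul_of_nonneg_left hyx hc]

/-- For `m ≥ 3` and `Π ≤ 2π₀`, with friend-edge weights in
`[0, (Π/(2π₀+Π))·min{π_{2i-1}, π_{2i}}]` and center-edge weights
`q_{0,2i-1} = 2π₀π_{2i-1}/(2π₀+Π)`, `q_{0,2i} = 2π₀π_{2i}/(2π₀+Π)`,
the matrix `P = I - D⁻¹L(q)` is stochastic with SLEM `Π/(2π₀+Π)`. -/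
theorem stmt_5 {m : ℕ} (hm : 3 ≤ m)
    (pr : Fin (2*m+1) → ℝ) (hpr : ∀ v, 0 < pr v)
    (PP : ℝ) (hPP : PP = ∑ i : Fin m, (pr (v1 i) + pr (v2 i)))
    (hPPle : PP ≤ 2 * pr v0)
    (q : Fin (2*m+1) → Fin (2*m+1) → ℝ)
    (hsymm : ∀ a b, q a b = q b a)
    (hqnn : ∀ a b, 0 ≤ q a b)
    (hedge : ∀ a b, ¬ IsEdge a b → q a b = 0)
    (hfr : ∀ i : Fin m,
      q (v1 i) (v2 i) ≤ (PP / (2 * pr v0 + PP)) * min (pr (v1 i)) (pr (v2 i)))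
    (hc1 : ∀ i : Fin m, q v0 (v1 i) = 2 * pr v0 * pr (v1 i) / (2 * pr v0 + PP))
    (hc2 : ∀ i : Fin m, q v0 (v2 i) = 2 * pr v0 * pr (v2 i) / (2 * pr v0 + PP)) :
    IsStochastic (transP pr q) ∧ slem (transP pr q) = PP / (2 * pr v0 + PP) := by
  have h0 := hpr v0
  have hPP0 : 0 < PP := by
    rw [hPP]
    have : Nonempty (Fin m) := ⟨⟨0, by omega⟩⟩
    exact Finset.sum_pos (fun i _ => add_pos (hpr _) (hpr _)) Finset.univ_nonempty
  have hd : 0 < 2 * pr v0 + PP := by positivity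
  set r := PP / (2 * pr v0 + PP) with hr
  have hr0 : 0 < r := by positivity
  have hr2 : 2 * r ≤ 1 := by
    rw [hr, ← mul_div_assoc, div_le_one hd]
    linarith
  have hc {x : ℝ} : 2 * pr v0 * x / (2 * pr v0 + PP) = (1 - r) * x := by
    rw [hr]
    field_simp
    ring
  have hrr : (1 - r) * PP = 2 * r * pr v0 := by
    rw [hr]
    field_simp
    ring
  simp only [hc] at hc1 hc2
  have hf1 (i : Fin m) : q (v1 i) (v2 i) ≤ r * pr (v1 i) :=
    (hfr i).trans (mul_le_mul_of_nonneg_left (min_le_left _ _) hr0.le)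
  have hf2 (i : Fin m) : q (v1 i) (v2 i) ≤ r * pr (v2 i) :=
    (hfr i).trans (mul_le_mul_of_nonneg_left (min_le_right _ _) hr0.le)
  have hrow0 (g : Fin (2 * m + 1) → ℝ) : ∑ k, q v0 k * g k =
      (1 - r) * ∑ i : Fin m, (pr (v1 i) * g (v1 i) + pr (v2 i) * g (v2 i)) := by
    rw [sum_row_v0 hedge, Finset.mul_sum]
    refine Finset.sum_congr rfl fun i _ => ?_
    rw [hc1, hc2]
    ring
  have hrow1 (g : Fin (2 * m + 1) → ℝ) (i : Fin m) : ∑ k, q (v1 i) k * g k =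
      (1 - r) * pr (v1 i) * g v0 + q (v1 i) (v2 i) * g (v2 i) := by
    rw [sum_row_v1 hsymm hedge, hc1]
  have hrow2 (g : Fin (2 * m + 1) → ℝ) (i : Fin m) : ∑ k, q (v2 i) k * g k =
      (1 - r) * pr (v2 i) * g v0 + q (v1 i) (v2 i) * g (v1 i) := by
    rw [sum_row_v2 hsymm hedge, hc2]
  refine ⟨isStochastic_transP hpr hqnn fun v => ?_, ?_⟩
  · have hone (v) : ∑ k, q v k = ∑ k, q v k * (fun _ => (1 : ℝ)) k := by simp
    rw [hone]
    rcases vertex_cases v with rfl | ⟨i, rfl⟩ | ⟨i, rfl⟩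
    · rw [hrow0]
      simp only [mul_one, ← hPP, hrr]
      nlinarith
    · rw [hrow1]
      linarith [hf1 i]
    · rw [hrow2]
      linarith [hf2 i]
  refine IsGreatest.csSup_eq ⟨⟨-r, ?_, by rw [abs_neg, abs_of_pos hr0]⟩, ?_⟩
  · rw [Multiset.mem_erase_of_ne (by linarith), mem_roots_charpoly_iff]
    refine ⟨fun v => if v = v0 then PP else -pr v0, fun h => ?_, ?_⟩
    · exact hPP0.ne' (by simpa using congrFun h v0)
    ext v
    have hv1 (i : Fin m) : v1 i ≠ v0 := by simp [v0, v1]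
    have hv2 (i : Fin m) : v2 i ≠ v0 := by simp [v0, v2]
    rw [transP_mulVec hpr]
    rcases vertex_cases v with rfl | ⟨i, rfl⟩ | ⟨i, rfl⟩
    · rw [hrow0 (fun k => _ - _)]
      simp only [if_true, hv1, hv2, if_false, ← add_mul, ← Finset.sum_mul, ← hPP,
        Pi.smul_apply, smul_eq_mul, ← mul_assoc, hrr]
      field_simp
      linarith
    · rw [hrow1 (fun k => _ - _)]
      have := (hpr (v1 i)).ne'
      simp only [if_true, hv1, hv2, if_false, Pi.smul_apply, smul_eq_mul]
      field_simp
      linear_combination pr (v1 i) * hrr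
    · rw [hrow2 (fun k => _ - _)]
      have := (hpr (v2 i)).ne'
      simp only [if_true, hv1, hv2, if_false, Pi.smul_apply, smul_eq_mul]
      field_simp
      linear_combination pr (v2 i) * hrr
  · rintro _ ⟨lam, hlam, rfl⟩
    obtain ⟨f, hf, hMf, hmean⟩ := exists_mean_zero_eigenvector hpr
      (mul_transP_comm hpr hsymm) (sum_transP hpr q) hlam
    have heq (v) : pr v * (lam * f v) = pr v * f v - ∑ k, q v k * (f v - f k) := by
      have h := congrFun hMf v
      rw [transP_mulVec hpr, Pi.smul_apply, smul_eq_mul] at h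
      rw [← h, mul_sub, mul_inv_cancel_left₀ (hpr v).ne']
    rw [sum_friendship] at hmean
    by_cases hx : f v0 = 0
    · obtain ⟨i, hi⟩ : ∃ i : Fin m, f (v1 i) ≠ 0 ∨ f (v2 i) ≠ 0 := by
        by_contra! h
        refine hf (funext fun v => ?_)
        rcases vertex_cases v with rfl | ⟨i, rfl⟩ | ⟨i, rfl⟩
        exacts [hx, (h i).1, (h i).2]
      have e1 := heq (v1 i)
      have e2 := heq (v2 i)
      rw [hrow1 (fun k => _ - _), hx] at e1
      rw [hrow2 (fun k => _ - _), hx] at e2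
      have hq := hqnn (v1 i) (v2 i)
      rcases le_total |f (v2 i)| |f (v1 i)| with hle | hle
      · exact abs_le_of_weighted_pair (hpr _) hq (hf1 i) hle
          (fun h => by rw [h, abs_zero, abs_nonpos_iff] at hle; tauto) (by linarith)
      · exact abs_le_of_weighted_pair (hpr _) hq (hf2 i) hle
          (fun h => by rw [h, abs_zero, abs_nonpos_iff] at hle; tauto) (by linarith)
    · have e0 := heq v0
      rw [hrow0 (fun k => _ - _)] at e0
      simp only [mul_sub, Finset.sum_add_distrib, Finset.sum_sub_distrib, ← Finset.sum_mul]
        at e0 hmean hPP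
      have h : (lam + r) * (pr v0 * f v0) = 0 := by
        linear_combination e0 + (1 - r) * hmean + f v0 * (1 - r) * hPP - f v0 * hrr
      have : lam = -r := eq_neg_of_add_eq_zero_left
        ((mul_eq_zero.1 h).resolve_right (mul_ne_zero h0.ne' hx))
      rw [this, abs_neg, abs_of_pos hr0]
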